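/- Let b1, bp, bm, c, e, h10, h01, h01', h02 be integers satisfying: e = 2 − 2·b1 + bp + bm; 3·(bp − bm) = c − 2e; 12·(1 − h01' + h02) = c + e; bp ≥ 2·h02; b1 = h10 + h01; h10 ≤ h01; and h01 ≤ h01'. Set σ = bp − bm and χ = 1 − h01 + h02. Then: (a) h01 = h01'; (b) σ = 4χ − e; (c) 12χ = c + e; and (d) either b1 = 2·h01, h10 = h01, bp = 2·h02 + 1, and bp + bm − 2·h02 = bm + 1, or b1 = 2·h01 − 1, h01 = h10 + 1, bp = 2·h02, and bp + bm − 2·h02 = bm. -/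

import Mathlib

/-- the full numerical content of the main theorem on Hodge
numbers of compact complex surfaces.  From the Euler characteristic formula,
Hirzebruch's signature theorem, the index formula for `∂̄ + ∂̄*`, the
geometric genus inequality, `b¹ = h¹⁰ + h⁰¹` and `h¹⁰ ≤ h⁰¹ ≤ h⁰¹_∂̄`, one
deduces: (a) `h⁰¹ = h⁰¹_∂̄`; (b) the signature formula `σ = 4χ - e`;
(c) Noether's formula `12χ = c + e`; and (d) the Kähler/non-Kähler dichotomy. -/
theorem hodge_numbers_complex_surface
    (b1 bp bm c e h10 h01 h01' h02 σ χ : ℤ)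
    (he : e = 2 - 2 * b1 + bp + bm)
    (hsig : 3 * (bp - bm) = c - 2 * e)
    (hind : 12 * (1 - h01' + h02) = c + e)
    (hgenus : bp ≥ 2 * h02)
    (hb1 : b1 = h10 + h01)
    (h1 : h10 ≤ h01)
    (h2 : h01 ≤ h01')
    (hσ : σ = bp - bm)
    (hχ : χ = 1 - h01 + h02) :
    h01 = h01' ∧
    σ = 4 * χ - e ∧
    12 * χ = c + e ∧
    ((b1 = 2 * h01 ∧ h10 = h01 ∧ bp = 2 * h02 + 1 ∧ bp + bm - 2 * h02 = bm + 1) ∨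
     (b1 = 2 * h01 - 1 ∧ h01 = h10 + 1 ∧ bp = 2 * h02 ∧ bp + bm - 2 * h02 = bm)) := by
  have key : (bp - 2 * h02) + 2 * (h01' - h01) + (h01 - h10) = 1 := by omega
  have ha : h01 = h01' := by omega
  refine ⟨ha, by omega, by omega, ?_⟩
  rcases (by omega : h10 = h01 ∨ h01 = h10 + 1) with h | h
  · left; omega
  · right; omega
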